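/- Let F be a γ-pliable set family on a finite set V that is symmetric, i.e., V \ S ∈ F whenever S ∈ F. Let 𝒞 be the family of F-cores, and let I be an inclusion-minimal cover of F such that every edge of I covers some F-core. Then ∑_{C ∈ 𝒞} d_I(C) ≤ 10·(|𝒞| − 1). -/

import Mathlib

open scoped Classical

namespace SFEC

variable {V : Type*}

/-- An edge (an unordered pair of distinct elements) `e` covers a set `S`
if exactly one endpoint of `e` lies in `S`. -/
def Covers (e : Sym2 V) (S : Set V) : Prop :=
  ∃ u v : V, e = s(u, v) ∧ u ∈ S ∧ v ∉ S

/-- `delta I S` is the set of edges of `I` with exactly one endpoint in `S`. -/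
noncomputable def delta (I : Finset (Sym2 V)) (S : Set V) : Finset (Sym2 V) :=
  I.filter (fun e => Covers e S)

/-- `d I S = |delta I S|`. -/
noncomputable def d (I : Finset (Sym2 V)) (S : Set V) : ℕ := (delta I S).card

/-- A set family on `V`: a collection of subsets with `∅ ∉ F` and `V ∉ F`. -/
def IsSetFamily (F : Set (Set V)) : Prop := ∅ ∉ F ∧ Set.univ ∉ F

/-- `I` covers the family `F` if it covers every member of `F`. -/
def CoversFam (I : Finset (Sym2 V)) (F : Set (Set V)) : Prop := ∀ S ∈ F, 1 ≤ d I S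

/-- `I` is an inclusion-minimal cover of `F`. -/
def MinimalCover (I : Finset (Sym2 V)) (F : Set (Set V)) : Prop :=
  CoversFam I F ∧ ∀ J : Finset (Sym2 V), J ⊂ I → ¬ CoversFam J F

/-- At least two of the four statements hold. -/
def AtLeastTwo (p q r s : Prop) : Prop :=
  (p ∧ q) ∨ (p ∧ r) ∨ (p ∧ s) ∨ (q ∧ r) ∨ (q ∧ s) ∨ (r ∧ s)

/-- A family is pliable if for all `A, B ∈ F` at least two of the four sets
`A ∩ B, A ∪ B, A \ B, B \ A` belong to `F`. -/
def Pliable (F : Set (Set V)) : Prop :=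
  ∀ A ∈ F, ∀ B ∈ F, AtLeastTwo (A ∩ B ∈ F) (A ∪ B ∈ F) (A \ B ∈ F) (B \ A ∈ F)

/-- The residual family `F^I`: the members of `F` covered by no edge of `I`. -/
def Residual (F : Set (Set V)) (I : Finset (Sym2 V)) : Set (Set V) := {S ∈ F | d I S = 0}

/-- `A` and `B` cross if `A ∩ B`, `A \ B`, `B \ A` and `V \ (A ∪ B)` are all nonempty. -/
def Crosses (A B : Set V) : Prop :=
  (A ∩ B).Nonempty ∧ (A \ B).Nonempty ∧ (B \ A).Nonempty ∧ ((A ∪ B)ᶜ : Set V).Nonempty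

/-- An `F`-core: an inclusion-minimal member of `F`. -/
def Core (F : Set (Set V)) (C : Set V) : Prop := C ∈ F ∧ ∀ A ∈ F, A ⊆ C → A = C

/-- Property (γ). -/
def PropertyGamma (F : Set (Set V)) : Prop :=
  ∀ (J : Finset (Sym2 V)) (S₁ S₂ C : Set V),
    S₁ ∈ Residual F J → S₂ ∈ Residual F J → S₁ ⊂ S₂ →
    Core (Residual F J) C → Crosses C S₁ → Crosses C S₂ →
    S₂ \ (S₁ ∪ C) = ∅ ∨ S₂ \ (S₁ ∪ C) ∈ Residual F J

/-- `F` is γ-pliable: pliable and satisfying Property (γ). -/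
def GammaPliable (F : Set (Set V)) : Prop := Pliable F ∧ PropertyGamma F

/-- `S` is a witness set for the edge `e ∈ I` if `δ_I(S) = {e}`. -/
def WitnessSet (F : Set (Set V)) (I : Finset (Sym2 V)) (S : Set V) (e : Sym2 V) : Prop :=
  S ∈ F ∧ delta I S = {e}

/-- `L ⊆ F` is a witness family for `I`: `|L| = |I|` and each `e ∈ I` has a witness set in `L`. -/
def WitnessFamily (F : Set (Set V)) (I : Finset (Sym2 V)) (L : Finset (Set V)) : Prop :=
  ↑L ⊆ F ∧ L.card = I.card ∧ ∀ e ∈ I, ∃ S ∈ L, WitnessSet F I S e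

/-- A family is laminar if any two members are disjoint or one contains the other. -/
def Laminar (L : Finset (Set V)) : Prop :=
  ∀ A ∈ L, ∀ B ∈ L, A ⊆ B ∨ B ⊆ A ∨ Disjoint A B

/-- `S ∈ L` owns `C` if `S` is the inclusion-minimal member of `L` containing `C`. -/
def Owns (L : Finset (Set V)) (S C : Set V) : Prop :=
  S ∈ L ∧ C ⊆ S ∧ ∀ T ∈ L, C ⊆ T → S ⊆ T

/-- `S ∈ L` is hollow if it owns no `F`-core. -/
def Hollow (F : Set (Set V)) (L : Finset (Set V)) (S : Set V) : Prop :=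
  S ∈ L ∧ ∀ C : Set V, Core F C → ¬ Owns L S C

/-- `A` is the unique child of `S` in `L`: the unique maximal member of `L`
properly contained in `S`. -/
def UniqueChild (L : Finset (Set V)) (A S : Set V) : Prop :=
  A ∈ L ∧ A ⊂ S ∧ ∀ B ∈ L, B ⊂ S → B ⊆ A

/-- `(S 0, S 1, …, S ℓ)` is a hollow chain in `L`. -/
def HollowChain (F : Set (Set V)) (L : Finset (Set V)) (S : ℕ → Set V) (ℓ : ℕ) : Prop :=
  (∀ i ≤ ℓ, S i ∈ L) ∧
  (∀ i, 1 ≤ i → i ≤ ℓ → Hollow F L (S i)) ∧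
  S ℓ ≠ Set.univ ∧
  (∀ i, 1 ≤ i → i ≤ ℓ → UniqueChild L (S (i - 1)) (S i))

/-- `U`: the union of all `F`-cores. -/
def coreUnion (F : Set (Set V)) : Set V := ⋃₀ {C | Core F C}

/-- `F` is uncrossable. -/
def Uncrossable (F : Set (Set V)) : Prop :=
  ∀ A ∈ F, ∀ B ∈ F, (A ∩ B ∈ F ∧ A ∪ B ∈ F) ∨ (A \ B ∈ F ∧ B \ A ∈ F)

/-- `F` is semi-uncrossable. -/
def SemiUncrossable (F : Set (Set V)) : Prop :=
  ∀ A ∈ F, ∀ B ∈ F,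
    (A ∩ B ∈ F ∧ (A ∪ B ∈ F ∨ A \ B ∈ F ∨ B \ A ∈ F)) ∨ (A \ B ∈ F ∧ B \ A ∈ F)

theorem covers_mk {u v : V} {S : Set V} :
    Covers s(u, v) S ↔ (u ∈ S ∧ v ∉ S) ∨ (v ∈ S ∧ u ∉ S) := by
  constructor
  · rintro ⟨x, y, h, hx, hy⟩
    rcases Sym2.eq_iff.1 h with ⟨rfl, rfl⟩ | ⟨rfl, rfl⟩
    · exact Or.inl ⟨hx, hy⟩
    · exact Or.inr ⟨hx, hy⟩
  · rintro (⟨hu, hv⟩ | ⟨hv, hu⟩)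
    · exact ⟨u, v, rfl, hu, hv⟩
    · exact ⟨v, u, Sym2.eq_swap, hv, hu⟩

theorem covers_compl {e : Sym2 V} {S : Set V} : Covers e Sᶜ ↔ Covers e S := by
  induction e with
  | _ u v => simp only [covers_mk, Set.mem_compl_iff]; tauto

theorem Covers.inter {e : Sym2 V} {A B : Set V} (h : Covers e (A ∩ B)) :
    Covers e A ∨ Covers e B := by
  induction e with
  | _ u v => simp only [covers_mk, Set.mem_inter_iff] at *; tauto

theorem Covers.union {e : Sym2 V} {A B : Set V} (h : Covers e (A ∪ B)) :
    Covers e A ∨ Covers e B := by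
  induction e with
  | _ u v => simp only [covers_mk, Set.mem_union] at *; tauto

theorem Covers.diff {e : Sym2 V} {A B : Set V} (h : Covers e (A \ B)) :
    Covers e A ∨ Covers e B := by
  induction e with
  | _ u v => simp only [covers_mk, Set.mem_sdiff] at *; tauto

theorem witnessSet_iff {F : Set (Set V)} {I : Finset (Sym2 V)} {S : Set V} {e : Sym2 V} :
    WitnessSet F I S e ↔ S ∈ F ∧ e ∈ I ∧ Covers e S ∧ ∀ f ∈ I, Covers f S → f = e := by
  simp only [WitnessSet, delta, Finset.ext_iff, Finset.mem_filter, Finset.mem_singleton]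
  constructor
  · rintro ⟨h, h'⟩
    have := (h' e).2 rfl
    exact ⟨h, this.1, this.2, fun f hf hc => (h' f).1 ⟨hf, hc⟩⟩
  · rintro ⟨h, he, hc, hu⟩
    exact ⟨h, fun f => ⟨fun hf => hu f hf.1 hf.2, by rintro rfl; exact ⟨he, hc⟩⟩⟩

theorem not_crosses_compl_right {A B : Set V} (h : ¬ Crosses A B) : ¬ Crosses A Bᶜ := by
  rintro ⟨h1, h2, h3, h4⟩
  refine h ⟨?_, ?_, ?_, ?_⟩
  · rwa [Set.sdiff_eq, compl_compl] at h2
  · rwa [Set.sdiff_eq]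
  · rwa [Set.compl_union, compl_compl, Set.inter_comm, ← Set.sdiff_eq] at h4
  · rwa [Set.compl_union, Set.inter_comm, ← Set.sdiff_eq]

theorem crosses_comm {A B : Set V} : Crosses A B ↔ Crosses B A := by
  simp only [Crosses, Set.inter_comm A B, Set.union_comm A B]
  tauto

section Uncrossing

variable {F : Set (Set V)} {I : Finset (Sym2 V)}

theorem WitnessSet.compl (hs : ∀ S ∈ F, Sᶜ ∈ F) {S : Set V} {e : Sym2 V}
    (h : WitnessSet F I S e) : WitnessSet F I Sᶜ e := by
  rw [witnessSet_iff] at *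
  simpa only [covers_compl] using ⟨hs _ h.1, h.2⟩

/-- A corner of two witness sets that is not covered by the edge of the first set
is a witness set for the edge of the second. -/
theorem WitnessSet.of_corner (hc : ∀ S ∈ F, ∃ e ∈ I, Covers e S) {A B X : Set V} {a b : Sym2 V}
    (hA : WitnessSet F I A a) (hB : WitnessSet F I B b) (hX : X ∈ F)
    (hcov : ∀ f, Covers f X → Covers f A ∨ Covers f B) (ha : ¬ Covers a X) :
    WitnessSet F I X b := by
  rw [witnessSet_iff] at *
  have key : ∀ f ∈ I, Covers f X → f = b := by
    intro f hf hfX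
    rcases hcov f hfX with h | h
    · exact absurd (hA.2.2.2 f hf h ▸ hfX) ha
    · exact hB.2.2.2 f hf h
  obtain ⟨f, hf, hfX⟩ := hc X hX
  exact ⟨hX, hB.2.1, key f hf hfX ▸ hfX, key⟩

/-- Every edge `a` has a witness set `A` such that all edges have a witness set not crossing `A`. -/
theorem exists_witnessSet_not_crosses [Finite V] (hP : Pliable F) (hs : ∀ S ∈ F, Sᶜ ∈ F)
    (hc : ∀ S ∈ F, ∃ e ∈ I, Covers e S) (hw : ∀ e ∈ I, ∃ S, WitnessSet F I S e)
    {a : Sym2 V} (ha : a ∈ I) :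
    ∃ A, WitnessSet F I A a ∧ ∀ b ∈ I, ∃ B, WitnessSet F I B b ∧ ¬ Crosses A B := by
  induction a with
  | _ u v =>
  let P : Set (Set V) := {A | WitnessSet F I A s(u, v) ∧ u ∈ A ∧ v ∉ A}
  let Q : Set (Set V) := {A | A ∈ P ∧ ∀ x y, s(x, y) ∈ I → x ∉ A → y ∉ A →
    ∃ C, WitnessSet F I C s(x, y) ∧ Disjoint C A}
  have hPne : P.Nonempty := by
    obtain ⟨A, hA⟩ := hw _ ha
    rcases covers_mk.1 (witnessSet_iff.1 hA).2.2.1 with h | h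
    · exact ⟨A, hA, h⟩
    · exact ⟨Aᶜ, hA.compl hs, h.2, fun h' => h' h.1⟩
  have hQne : Q.Nonempty := by
    obtain ⟨A, hA⟩ := (Set.toFinite P).exists_minimal hPne
    obtain ⟨hAw, hu, hv⟩ := hA.prop
    refine ⟨A, hA.prop, fun x y hxy hx hy => ?_⟩
    have hne : s(u, v) ≠ s(x, y) := by
      intro h
      rcases Sym2.eq_iff.1 h with ⟨rfl, rfl⟩ | ⟨rfl, rfl⟩ <;> contradiction
    obtain ⟨C, hCw, hCu⟩ : ∃ C, WitnessSet F I C s(x, y) ∧ u ∉ C := by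
      obtain ⟨C, hC⟩ := hw _ hxy
      by_cases h : u ∈ C
      · exact ⟨Cᶜ, hC.compl hs, fun h' => h' h⟩
      · exact ⟨C, hC, h⟩
    have hCv : v ∉ C := by
      intro h
      exact hne ((witnessSet_iff.1 hCw).2.2.2 _ ha (covers_mk.2 (Or.inr ⟨h, hCu⟩)))
    by_cases h1 : A \ C ∈ F
    · have h2 : WitnessSet F I (A \ C) s(u, v) :=
        WitnessSet.of_corner hc hCw hAw h1 (fun f hf => hf.diff.symm)
          (by simp only [covers_mk, Set.mem_sdiff]; tauto)
      have h3 : A ≤ A \ C := hA.le_of_le ⟨h2, ⟨hu, hCu⟩, fun h => hv h.1⟩ Set.sdiff_subset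
      refine ⟨C, hCw, ?_⟩
      rw [Set.disjoint_left]
      exact fun z hz hzA => (h3 hzA).2 hz
    · have h2 : A ∩ C ∉ F := by
        intro h
        have := WitnessSet.of_corner hc hCw hAw h (fun f hf => hf.inter.symm)
          (by simp only [covers_mk, Set.mem_inter_iff]; tauto)
        have := (witnessSet_iff.1 this).2.2.1
        simp only [covers_mk, Set.mem_inter_iff] at this
        tauto
      have h3 : C \ A ∈ F := by
        have := hP A hAw.1 C hCw.1
        unfold AtLeastTwo at this
        tauto
      refine ⟨C \ A, WitnessSet.of_corner hc hAw hCw h3 (fun f hf => hf.diff.symm) ?_,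
        Set.disjoint_sdiff_left⟩
      simp only [covers_mk, Set.mem_sdiff]; tauto
  obtain ⟨A, hA⟩ := (Set.toFinite Q).exists_maximal hQne
  obtain ⟨⟨hAw, hu, hv⟩, hout⟩ := hA.prop
  refine ⟨A, hAw, fun b hb => ?_⟩
  by_cases hba : b = s(u, v)
  · exact ⟨A, hba ▸ hAw, fun h => by simpa using h.2.1⟩
  induction b with
  | _ x y =>
  have hnc : ¬ Covers s(x, y) A := fun h => hba ((witnessSet_iff.1 hAw).2.2.2 _ hb h)
  rw [covers_mk] at hnc
  by_cases hx : x ∉ A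
  · obtain ⟨C, hC, hd⟩ := hout x y hb hx (by tauto)
    refine ⟨C, hC, fun h => ?_⟩
    obtain ⟨z, hz⟩ := h.1
    exact Set.disjoint_left.1 hd hz.2 hz.1
  have hx : x ∈ A := by tauto
  have hy : y ∈ A := by tauto
  let R : Set (Set V) := {B | WitnessSet F I B s(x, y) ∧ u ∈ B ∧ v ∈ B}
  have hRne : R.Nonempty := by
    obtain ⟨B, hB⟩ := hw _ hb
    have h1 : ¬ Covers s(u, v) B := fun h => hba ((witnessSet_iff.1 hB).2.2.2 _ ha h).symm
    rw [covers_mk] at h1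
    by_cases h : u ∈ B
    · exact ⟨B, hB, h, by tauto⟩
    · exact ⟨Bᶜ, hB.compl hs, h, show v ∉ B by tauto⟩
  obtain ⟨B, hB⟩ := (Set.toFinite R).exists_maximal hRne
  obtain ⟨hBw, huB, hvB⟩ := hB.prop
  by_cases h1 : A \ B ∈ F
  · refine ⟨A \ B, WitnessSet.of_corner hc hAw hBw h1 (fun f hf => hf.diff) ?_, ?_⟩
    · simp only [covers_mk, Set.mem_sdiff]; tauto
    · rintro ⟨-, -, ⟨z, hz⟩, -⟩
      exact hz.2 hz.1.1
  have h2 : A ∪ B ∉ F := by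
    intro h
    have := WitnessSet.of_corner hc hAw hBw h (fun f hf => hf.union)
      (by simp only [covers_mk, Set.mem_union]; tauto)
    have := (witnessSet_iff.1 this).2.2.1
    simp only [covers_mk, Set.mem_union] at this
    tauto
  have h3 : B \ A ∈ F := by
    have := hP A hAw.1 B hBw.1
    unfold AtLeastTwo at this
    tauto
  have h4 : WitnessSet F I (B \ A) s(u, v) :=
    WitnessSet.of_corner hc hBw hAw h3 (fun f hf => hf.diff)
      (by simp only [covers_mk, Set.mem_sdiff]; tauto)
  have h5 : (B \ A)ᶜ ∈ Q := by
    refine ⟨⟨h4.compl hs, fun h => h.2 hu, fun h => h ⟨hvB, hv⟩⟩, fun p q hpq hp hq => ?_⟩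
    rw [Set.notMem_compl_iff] at hp hq
    obtain ⟨C, hC, hd⟩ := hout p q hpq hp.2 hq.2
    have hCA : ∀ z ∈ A, z ∉ C := fun z hz hzC => Set.disjoint_left.1 hd hzC hz
    have hpB := hp.1
    have hqB := hq.1
    have hCx := hCA x hx
    have hCy := hCA y hy
    suffices hCB : C ∩ B ∈ F by
      refine ⟨C ∩ B, WitnessSet.of_corner hc hBw hC hCB (fun f hf => hf.inter.symm) ?_, ?_⟩
      · simp only [covers_mk, Set.mem_inter_iff]; tauto
      · rw [Set.disjoint_left]
        exact fun z hz hz' => hz' ⟨hz.2, fun h => hCA z h hz.1⟩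
    by_contra hCB
    have h6 : C \ B ∉ F := by
      intro h
      have := WitnessSet.of_corner hc hBw hC h (fun f hf => hf.diff.symm)
        (by simp only [covers_mk, Set.mem_sdiff]; tauto)
      have := (witnessSet_iff.1 this).2.2.1
      simp only [covers_mk, Set.mem_sdiff] at this
      tauto
    have h7 : C ∪ B ∈ F := by
      have := hP C hC.1 B hBw.1
      unfold AtLeastTwo at this
      tauto
    have h8 : WitnessSet F I (C ∪ B) s(x, y) :=
      WitnessSet.of_corner hc hC hBw h7 (fun f hf => hf.union)
        (by simp only [covers_mk, Set.mem_union]; tauto)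
    have h9 : C ∪ B ≤ B :=
      hB.le_of_ge ⟨h8, Or.inr huB, Or.inr hvB⟩ Set.subset_union_right
    exact hCB ((Set.inter_eq_left.2 (Set.subset_union_left.trans h9)).symm ▸ hC.1)
  have h6 : (B \ A)ᶜ ≤ A := hA.le_of_ge h5 (fun z hz h => h.2 hz)
  refine ⟨B, hBw, ?_⟩
  rintro ⟨-, -, -, ⟨z, hz⟩⟩
  exact hz (Or.inl (h6 fun h => hz (Or.inr h.1)))

/-- The members of a symmetric pliable family that do not cross a given set form a pliable family. -/
theorem Pliable.not_crosses (hP : Pliable F) (hs : ∀ S ∈ F, Sᶜ ∈ F) (A : Set V) :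
    Pliable {S ∈ F | ¬ Crosses A S} := by
  have hs' : ∀ S ∈ {S ∈ F | ¬ Crosses A S}, Sᶜ ∈ {S ∈ F | ¬ Crosses A S} :=
    fun S hS => ⟨hs S hS.1, not_crosses_compl_right hS.2⟩
  intro S hS T hT
  by_cases hST : Crosses S T
  · obtain ⟨⟨p, hp⟩, ⟨q, hq⟩, ⟨r, hr⟩, ⟨t, ht⟩⟩ := hST
    have hnS := hS.2
    have hnT := hT.2
    have corner : ∀ X : Set V, (X = S ∩ T ∨ X = S ∪ T ∨ X = S \ T ∨ X = T \ S) →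
        ¬ Crosses A X := by
      intro X hX
      simp only [Crosses, Set.Nonempty, Set.mem_inter_iff, Set.mem_sdiff, Set.mem_compl_iff,
        Set.mem_union] at *
      rcases hX with rfl | rfl | rfl | rfl <;>
        (simp only [Set.mem_inter_iff, Set.mem_sdiff, Set.mem_union]; grind)
    have := hP S hS.1 T hT.1
    unfold AtLeastTwo at *
    have h1 := corner _ (Or.inl rfl)
    have h2 := corner _ (Or.inr (Or.inl rfl))
    have h3 := corner _ (Or.inr (Or.inr (Or.inl rfl)))
    have h4 := corner _ (Or.inr (Or.inr (Or.inr rfl)))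
    simp only [Set.mem_ofPred_eq]
    tauto
  · have hcase : S ∩ T = ∅ ∨ S \ T = ∅ ∨ T \ S = ∅ ∨ (S ∪ T)ᶜ = ∅ := by
      simp only [← Set.not_nonempty_iff_eq_empty]
      unfold Crosses at hST
      tauto
    rcases hcase with h | h | h | h
    · have h' := Set.disjoint_iff_inter_eq_empty.2 h
      rw [h'.sdiff_eq_left, h'.sdiff_eq_right]
      exact Or.inr (Or.inr (Or.inr (Or.inr (Or.inr ⟨hS, hT⟩))))
    · have h' := Set.sdiff_eq_empty.1 h
      rw [Set.inter_eq_left.2 h', Set.union_eq_right.2 h']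
      exact Or.inl ⟨hS, hT⟩
    · have h' := Set.sdiff_eq_empty.1 h
      rw [Set.inter_eq_right.2 h', Set.union_eq_left.2 h']
      exact Or.inl ⟨hT, hS⟩
    · have h1 : S \ T = Tᶜ := by
        ext z; have : z ∉ (S ∪ T)ᶜ := h ▸ Set.notMem_empty z
        simp at this ⊢; tauto
      have h2 : T \ S = Sᶜ := by
        ext z; have : z ∉ (S ∪ T)ᶜ := h ▸ Set.notMem_empty z
        simp at this ⊢; tauto
      rw [h1, h2]
      exact Or.inr (Or.inr (Or.inr (Or.inr (Or.inr ⟨hs' T hT, hs' S hS⟩))))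

theorem exists_subfamily_not_crosses [Finite V] (hP : Pliable F) (hs : ∀ S ∈ F, Sᶜ ∈ F)
    (hc : ∀ S ∈ F, ∃ e ∈ I, Covers e S) (hw : ∀ e ∈ I, ∃ S, WitnessSet F I S e)
    (J : Finset (Sym2 V)) (hJ : J ⊆ I) :
    ∃ G ⊆ F, Pliable G ∧ (∀ S ∈ G, Sᶜ ∈ G) ∧ (∀ e ∈ I, ∃ S, WitnessSet G I S e) ∧
      ∀ e ∈ J, ∃ A, WitnessSet G I A e ∧ ∀ B ∈ G, ¬ Crosses A B := by
  induction J using Finset.induction_on with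
  | empty => exact ⟨F, subset_rfl, hP, hs, hw, by simp⟩
  | insert a J _ ih =>
    obtain ⟨G, hGF, hGP, hGs, hGw, hGJ⟩ := ih ((Finset.subset_insert a J).trans hJ)
    obtain ⟨A, hA, hAB⟩ := exists_witnessSet_not_crosses hGP hGs (fun S hS => hc S (hGF hS)) hGw
      (hJ (Finset.mem_insert_self a J))
    have hAA : ¬ Crosses A A := fun h => by simpa using h.2.1
    refine ⟨{S ∈ G | ¬ Crosses A S}, fun S hS => hGF hS.1, hGP.not_crosses hGs A,
      fun S hS => ⟨hGs S hS.1, not_crosses_compl_right hS.2⟩, fun e he => ?_, fun e he => ?_⟩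
    · obtain ⟨B, hB, hn⟩ := hAB e he
      exact ⟨B, ⟨hB.1, hn⟩, hB.2⟩
    · rcases Finset.mem_insert.1 he with rfl | he
      · exact ⟨A, ⟨⟨hA.1, hAA⟩, hA.2⟩, fun B hB => hB.2⟩
      · obtain ⟨B, hB, hn⟩ := hGJ e he
        exact ⟨B, ⟨⟨hB.1, fun h => hn A hA.1 (crosses_comm.1 h)⟩, hB.2⟩, fun T hT => hn T hT.1⟩

/-- In a symmetric pliable family there are pairwise laminar witness sets avoiding a given
element. -/
theorem exists_laminar_witnessSets [Finite V] (hP : Pliable F) (hs : ∀ S ∈ F, Sᶜ ∈ F)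
    (hc : ∀ S ∈ F, ∃ e ∈ I, Covers e S) (hw : ∀ e ∈ I, ∃ S, WitnessSet F I S e) (r : V) :
    ∃ S : Sym2 V → Set V, (∀ e ∈ I, WitnessSet F I (S e) e ∧ r ∉ S e) ∧
      ∀ e ∈ I, ∀ f ∈ I, S e ⊆ S f ∨ S f ⊆ S e ∨ Disjoint (S e) (S f) := by
  obtain ⟨G, hGF, -, hGs, -, hGJ⟩ := exists_subfamily_not_crosses hP hs hc hw I subset_rfl
  have key : ∀ e ∈ I, ∃ A, WitnessSet G I A e ∧ r ∉ A ∧ ∀ B ∈ G, ¬ Crosses A B := by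
    intro e he
    obtain ⟨A, hA, hn⟩ := hGJ e he
    by_cases hr : r ∈ A
    · exact ⟨Aᶜ, hA.compl hGs, fun h => h hr, fun B hB h =>
        not_crosses_compl_right (fun h' => hn B hB (crosses_comm.1 h')) (crosses_comm.1 h)⟩
    · exact ⟨A, hA, hr, hn⟩
  choose! S hS using key
  refine ⟨S, fun e he => ⟨⟨hGF (hS e he).1.1, (hS e he).1.2⟩, (hS e he).2.1⟩,
    fun e he f hf => ?_⟩
  have h := (hS e he).2.2 _ (hS f hf).1.1
  simp only [Crosses, not_and_or, Set.not_nonempty_iff_eq_empty] at h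
  rcases h with h | h | h | h
  · exact Or.inr (Or.inr (Set.disjoint_iff_inter_eq_empty.2 h))
  · exact Or.inl (Set.sdiff_eq_empty.1 h)
  · exact Or.inr (Or.inl (Set.sdiff_eq_empty.1 h))
  · have : r ∈ (S e ∪ S f)ᶜ := fun hr => hr.elim (hS e he).2.1 (hS f hf).2.1
    simp [h] at this

end Uncrossing

section Cores

variable {F : Set (Set V)} {I : Finset (Sym2 V)}

theorem exists_core_subset [Finite V] {S : Set V} (hS : S ∈ F) : ∃ C, Core F C ∧ C ⊆ S := by
  obtain ⟨C, hCS, hC⟩ := (Set.toFinite F).exists_le_minimal hS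
  exact ⟨C, ⟨hC.prop, fun A hA hAC => subset_antisymm hAC (hC.le_of_le hA hAC)⟩, hCS⟩

theorem Core.diff_mem_and_union_mem (hP : Pliable F) {C A : Set V} (hC : Core F C) (hA : A ∈ F)
    (hne : (C ∩ A).Nonempty) (hn : ¬ C ⊆ A) : A \ C ∈ F ∧ A ∪ C ∈ F := by
  have h1 : A ∩ C ∉ F := fun h =>
    hn (Set.inter_eq_right.1 (hC.2 _ h Set.inter_subset_right))
  have h2 : C \ A ∉ F := by
    intro h
    have := hC.2 _ h Set.sdiff_subset
    obtain ⟨z, hz⟩ := hne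
    exact (this.symm.subset hz.1).2 hz.2
  have := hP A hA C hC.1
  unfold AtLeastTwo at this
  tauto

theorem Core.eq_of_mem (hP : Pliable F) {C D : Set V} (hC : Core F C) (hD : Core F D) {z : V}
    (hzC : z ∈ C) (hzD : z ∈ D) : C = D := by
  by_cases h : C ⊆ D
  · exact hD.2 _ hC.1 h
  · have h1 := (hC.diff_mem_and_union_mem hP hD.1 ⟨z, hzC, hzD⟩ h).1
    have h2 := hD.2 _ h1 Set.sdiff_subset
    exact absurd hzC (h2.symm.subset hzD).2

theorem Core.crosses (hF : IsSetFamily F) (hP : Pliable F) {C A : Set V} (hC : Core F C)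
    (hA : A ∈ F) (hne : (C ∩ A).Nonempty) (hn : ¬ C ⊆ A) : Crosses C A := by
  obtain ⟨h1, h2⟩ := hC.diff_mem_and_union_mem hP hA hne hn
  refine ⟨hne, Set.sdiff_nonempty.2 hn, ?_, ?_⟩
  · exact Set.nonempty_iff_ne_empty.2 fun h => hF.1 (h ▸ h1)
  · refine Set.nonempty_compl.2 fun h => hF.2 ?_
    rwa [← h, Set.union_comm]

theorem card_filter_covers_le_one {K : Finset (Set V)}
    (hK : ∀ C ∈ K, ∀ D ∈ K, ∀ z, z ∈ C → z ∈ D → C = D) {x y : V}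
    (hx : ∀ C ∈ K, Covers s(x, y) C → x ∉ C) : (K.filter (Covers s(x, y))).card ≤ 1 := by
  have hy : ∀ C ∈ K, Covers s(x, y) C → y ∈ C := by
    intro C hC h
    have := hx C hC h
    rw [covers_mk] at h
    tauto
  refine Finset.card_le_one.2 fun C hC D hD => ?_
  rw [Finset.mem_filter] at hC hD
  exact hK C hC.1 D hD.1 y (hy C hC.1 hC.2) (hy D hD.1 hD.2)

theorem card_filter_covers_le_two {K : Finset (Set V)}
    (hK : ∀ C ∈ K, ∀ D ∈ K, ∀ z, z ∈ C → z ∈ D → C = D) (e : Sym2 V) :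
    (K.filter (Covers e)).card ≤ 2 := by
  induction e with
  | _ x y =>
  have one : ∀ z, (K.filter (z ∈ ·)).card ≤ 1 := fun z =>
    Finset.card_le_one.2 fun C hC D hD => by
      rw [Finset.mem_filter] at hC hD
      exact hK C hC.1 D hD.1 z hC.2 hD.2
  calc (K.filter (Covers s(x, y))).card
      ≤ (K.filter (x ∈ ·) ∪ K.filter (y ∈ ·)).card := by
        refine Finset.card_le_card fun C hC => ?_
        rw [Finset.mem_filter, covers_mk] at hC
        rw [Finset.mem_union, Finset.mem_filter, Finset.mem_filter]
        tauto
    _ ≤ 1 + 1 := (Finset.card_union_le _ _).trans (add_le_add (one x) (one y))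

/-- A laminar family of nonempty subsets of `X` has at most `2 * |X|` members. -/
theorem card_le_two_mul_card_of_laminar {α : Type*} (X : Finset α) (L : Finset (Finset α))
    (hL : ∀ A ∈ L, A.Nonempty ∧ A ⊆ X)
    (hlam : ∀ A ∈ L, ∀ B ∈ L, A ⊆ B ∨ B ⊆ A ∨ Disjoint A B) : L.card ≤ 2 * X.card := by
  induction X using Finset.induction_on generalizing L with
  | empty =>
    have : L = ∅ := Finset.eq_empty_of_forall_notMem fun A hA =>
      (hL A hA).1.ne_empty (Finset.subset_empty.1 (hL A hA).2)
    simp [this]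
  | insert x X hx ih =>
    let L' := (L.image (fun A => A.erase x)).erase ∅
    let M := L.filter (fun A => x ∈ A ∧ A.erase x ∈ L)
    have hL' : L'.card ≤ 2 * X.card := by
      refine ih L' (fun A hA => ?_) (fun A hA B hB => ?_)
      · obtain ⟨hne, hA⟩ := Finset.mem_erase.1 hA
        obtain ⟨A, hAL, rfl⟩ := Finset.mem_image.1 hA
        exact ⟨Finset.nonempty_iff_ne_empty.2 hne, Finset.subset_insert_iff.1 (hL A hAL).2⟩
      · obtain ⟨A, hAL, rfl⟩ := Finset.mem_image.1 (Finset.mem_erase.1 hA).2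
        obtain ⟨B, hBL, rfl⟩ := Finset.mem_image.1 (Finset.mem_erase.1 hB).2
        rcases hlam A hAL B hBL with h | h | h
        · exact Or.inl (Finset.erase_subset_erase x h)
        · exact Or.inr (Or.inl (Finset.erase_subset_erase x h))
        · exact Or.inr (Or.inr (h.mono (Finset.erase_subset _ _) (Finset.erase_subset _ _)))
    have hM : M.card ≤ 1 := by
      have key : ∀ A ∈ M, ∀ B ∈ M, A ⊆ B → A = B := by
        intro A hA B hB hAB
        obtain ⟨hAL, hxA, hA'⟩ := Finset.mem_filter.1 hA
        obtain ⟨hBL, hxB, hB'⟩ := Finset.mem_filter.1 hB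
        obtain ⟨z, hz⟩ := (hL _ hA').1
        have hzA := Finset.mem_erase.1 hz
        rcases hlam A hAL _ hB' with h | h | h
        · exact absurd (h hxA) (Finset.notMem_erase x B)
        · refine subset_antisymm hAB fun w hw => ?_
          by_cases hwx : w = x
          · exact hwx ▸ hxA
          · exact h (Finset.mem_erase.2 ⟨hwx, hw⟩)
        · exact absurd (Finset.mem_erase.2 ⟨hzA.1, hAB hzA.2⟩)
            (Finset.disjoint_left.1 h hzA.2)
      refine Finset.card_le_one.2 fun A hA B hB => ?_
      have hA' := Finset.mem_filter.1 hA
      have hB' := Finset.mem_filter.1 hB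
      rcases hlam A hA'.1 B hB'.1 with h | h | h
      · exact key A hA B hB h
      · exact (key B hB A hA h).symm
      · exact absurd hB'.2.1 (Finset.disjoint_left.1 h hA'.2.1)
    have hinj : (L \ insert {x} M).card ≤ L'.card := by
      refine Finset.card_le_card_of_injOn (fun A => A.erase x) (fun A hA => ?_)
        (fun A hA B hB hAB => ?_)
      · simp only [Finset.coe_sdiff, Set.mem_sdiff, Finset.mem_coe, Finset.mem_insert, not_or] at hA
        refine Finset.mem_erase.2 ⟨fun h => ?_, Finset.mem_image_of_mem _ hA.1⟩
        rcases Finset.erase_eq_empty_iff _ _ |>.1 h with h | h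
        · exact (hL A hA.1).1.ne_empty h
        · exact hA.2.1 h
      · simp only [Finset.coe_sdiff, Set.mem_sdiff, Finset.mem_coe, Finset.mem_insert, not_or,
          M, Finset.mem_filter, not_and] at hA hB
        simp only at hAB
        by_cases hxA : x ∈ A <;> by_cases hxB : x ∈ B
        · rw [← Finset.insert_erase hxA, hAB, Finset.insert_erase hxB]
        · rw [Finset.erase_eq_of_notMem hxB] at hAB
          exact absurd (hAB ▸ hB.1) (hA.2.2 hA.1 hxA)
        · rw [Finset.erase_eq_of_notMem hxA] at hAB
          exact absurd (hAB ▸ hA.1) (hB.2.2 hB.1 hxB)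
        · rwa [Finset.erase_eq_of_notMem hxA, Finset.erase_eq_of_notMem hxB] at hAB
    have h1 := Finset.card_insert_le {x} M
    have h2 : L.card ≤ (L \ insert {x} M).card + (insert {x} M).card :=
      (Finset.card_le_card (Finset.sdiff_union_self_eq_union (s := L) ▸
        Finset.subset_union_left)).trans (Finset.card_union_le _ _)
    rw [Finset.card_insert_of_notMem hx]
    omega

/-- The witness sets `S e`, `e ∈ G`, form a chain and contain the same cores, and every
edge of `G` covers a core. -/
structure CoreChain (F : Set (Set V)) (I : Finset (Sym2 V)) (S : Sym2 V → Set V)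
    (G : Finset (Sym2 V)) : Prop where
  isSetFamily : IsSetFamily F
  gammaPliable : GammaPliable F
  witnessSet : ∀ e ∈ G, WitnessSet F I (S e) e
  covers : ∀ e ∈ G, ∃ C, Core F C ∧ Covers e C
  total : ∀ e ∈ G, ∀ f ∈ G, S e ⊆ S f ∨ S f ⊆ S e
  core_subset : ∀ e ∈ G, ∀ f ∈ G, ∀ C, Core F C → C ⊆ S e → C ⊆ S f

namespace CoreChain

variable {S : Sym2 V → Set V} {G : Finset (Sym2 V)}

theorem not_covers (h : CoreChain F I S G) {e f : Sym2 V} (he : e ∈ G) (hf : f ∈ G)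
    (hne : e ≠ f) : ¬ Covers e (S f) := fun hc =>
  hne ((witnessSet_iff.1 (h.witnessSet f hf)).2.2.2 e
    (witnessSet_iff.1 (h.witnessSet e he)).2.1 hc)

theorem exists_ends (h : CoreChain F I S G) {e : Sym2 V} (he : e ∈ G) :
    ∃ x y, e = s(x, y) ∧ x ∈ S e ∧ y ∉ S e :=
  (witnessSet_iff.1 (h.witnessSet e he)).2.2.1

theorem mem_of_subset (h : CoreChain F I S G) {x y : V} {f : Sym2 V} (he : s(x, y) ∈ G)
    (hf : f ∈ G) (hne : s(x, y) ≠ f) (hsub : S s(x, y) ⊆ S f) (hx : x ∈ S s(x, y)) :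
    y ∈ S f := by
  have := h.not_covers he hf hne
  rw [covers_mk] at this
  have := hsub hx
  tauto

theorem notMem_of_subset (h : CoreChain F I S G) {x y : V} {e : Sym2 V} (he : e ∈ G)
    (hf : s(x, y) ∈ G) (hne : e ≠ s(x, y)) (hsub : S e ⊆ S s(x, y)) (hy : y ∉ S s(x, y)) :
    x ∉ S e := by
  have := h.not_covers hf he hne.symm
  rw [covers_mk] at this
  have : y ∉ S e := fun h => hy (hsub h)
  tauto

theorem diff_subset_core [Finite V] (h : CoreChain F I S G) {e f g : Sym2 V} (he : e ∈ G)
    (hf : f ∈ G) (hg : g ∈ G) (hfg : S f ⊂ S g) {C : Set V} (hC : Core F C) {z : V}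
    (hzC : z ∈ C) (hzf : z ∈ S f) (hze : z ∉ S e) : S g \ S f ⊆ C := by
  have hnf : ¬ C ⊆ S f := fun hs => hze (h.core_subset f hf e he C hC hs hzC)
  have hng : ¬ C ⊆ S g := fun hs => hze (h.core_subset g hg e he C hC hs hzC)
  have hP := h.gammaPliable.1
  have hFf := (h.witnessSet f hf).1
  have hFg := (h.witnessSet g hg).1
  have hres : Residual F ∅ = F := by
    ext T
    simp [Residual, d, delta]
  have hg2 := h.gammaPliable.2 ∅ (S f) (S g) C
  rw [hres] at hg2
  rcases hg2 hFf hFg hfg hC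
    (hC.crosses h.isSetFamily hP hFf ⟨z, hzC, hzf⟩ hnf)
    (hC.crosses h.isSetFamily hP hFg ⟨z, hzC, hfg.1 hzf⟩ hng) with h0 | h0
  · intro w hw
    by_contra hwC
    have : w ∈ S g \ (S f ∪ C) := ⟨hw.1, fun h => h.elim hw.2 hwC⟩
    simp [h0] at this
  · obtain ⟨D, hD, hDs⟩ := exists_core_subset h0
    have h1 := h.core_subset g hg f hf D hD (hDs.trans Set.sdiff_subset)
    obtain ⟨w, hw⟩ : D.Nonempty :=
      Set.nonempty_iff_ne_empty.2 fun h' => h.isSetFamily.1 (h' ▸ hD.1)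
    exact absurd (Or.inl (h1 hw)) (hDs hw).2

theorem ssubset (h : CoreChain F I S G) {e f : Sym2 V} (he : e ∈ G) (hf : f ∈ G) (hne : e ≠ f)
    (hsub : S e ⊆ S f) : S e ⊂ S f := by
  refine hsub.ssubset_of_ne fun heq => ?_
  have := (witnessSet_iff.1 (h.witnessSet e he)).2.2.1
  exact h.not_covers he hf hne (heq ▸ this)

/-- A core covered by an edge from the middle of the chain contains only its outer end. -/
theorem notMem_core [Finite V] (h : CoreChain F I S G) {e g : Sym2 V} {x y : V} (he : e ∈ G)
    (hf : s(x, y) ∈ G) (hg : g ∈ G) (hef : S e ⊂ S s(x, y)) (hfg : S s(x, y) ⊂ S g)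
    (hx : x ∈ S s(x, y)) (hy : y ∉ S s(x, y)) {C : Set V} (hC : Core F C)
    (hcov : Covers s(x, y) C) : x ∉ C := by
  intro hxC
  have hne : e ≠ s(x, y) := fun h => hef.ne (h ▸ rfl)
  have hne' : s(x, y) ≠ g := fun h => hfg.ne (h ▸ rfl)
  have hxe := h.notMem_of_subset he hf hne hef.1 hy
  have hyg := h.mem_of_subset hf hg hne' hfg.1 hx
  have hyC := h.diff_subset_core he hf hg hfg hC hxC hx hxe ⟨hyg, hy⟩
  rw [covers_mk] at hcov
  tauto

theorem exists_mem_core [Finite V] (h : CoreChain F I S G) {e f g : Sym2 V} (he : e ∈ G)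
    (hf : f ∈ G) (hg : g ∈ G) (hef : S e ⊂ S f) (hfg : S f ⊂ S g) :
    ∃ C, Core F C ∧ ∃ z ∈ C, z ∈ S g ∧ z ∉ S f := by
  obtain ⟨x, y, rfl, hx, hy⟩ := h.exists_ends hf
  obtain ⟨C, hC, hcov⟩ := h.covers _ hf
  have hxC := h.notMem_core he hf hg hef hfg hx hy hC hcov
  have hne' : s(x, y) ≠ g := fun h => hfg.ne (h ▸ rfl)
  rw [covers_mk] at hcov
  exact ⟨C, hC, y, by tauto, h.mem_of_subset hf hg hne' hfg.1 hx, hy⟩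

theorem not_diff_subset_core (h : CoreChain F I S G) {e f g : Sym2 V} (he : e ∈ G)
    (hf : f ∈ G) (hg : g ∈ G) (hef : S e ⊂ S f) (hfg : S f ⊂ S g) {C : Set V}
    (hC : Core F C) : ¬ S g \ S e ⊆ C := by
  intro hsub
  obtain ⟨x, y, rfl, hx, hy⟩ := h.exists_ends hf
  have hne : e ≠ s(x, y) := fun h => hef.ne (h ▸ rfl)
  have hne' : s(x, y) ≠ g := fun h => hfg.ne (h ▸ rfl)
  have hxC : x ∈ C := hsub ⟨hfg.1 hx, h.notMem_of_subset he hf hne hef.1 hy⟩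
  have hyC : y ∈ C := hsub ⟨h.mem_of_subset hf hg hne' hfg.1 hx, fun h => hy (hef.1 h)⟩
  obtain ⟨D, hD, hcov⟩ := h.covers _ hf
  have hP := h.gammaPliable.1
  rw [covers_mk] at hcov
  rcases hcov with ⟨h1, h2⟩ | ⟨h1, h2⟩
  · exact h2 (hC.eq_of_mem hP hD hxC h1 ▸ hyC)
  · exact h2 (hC.eq_of_mem hP hD hyC h1 ▸ hxC)

theorem exists_first (h : CoreChain F I S G) {H : Finset (Sym2 V)} (hH : H ⊆ G)
    (hne : H.Nonempty) : ∃ e ∈ H, ∀ f ∈ H.erase e, S e ⊂ S f := by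
  obtain ⟨e, he⟩ := H.exists_minimalFor S hne
  refine ⟨e, he.1, fun f hf => ?_⟩
  obtain ⟨hfe, hf⟩ := Finset.mem_erase.1 hf
  refine h.ssubset (hH he.1) (hH hf) hfe.symm ?_
  rcases h.total e (hH he.1) f (hH hf) with h1 | h1
  · exact h1
  · exact he.2 hf h1

theorem sum_le_five [Finite V] (h : CoreChain F I S G) {K : Finset (Set V)}
    (hK : ∀ C, C ∈ K ↔ Core F C) : ∑ e ∈ G, (K.filter (Covers e)).card ≤ 5 := by
  have hP := h.gammaPliable.1
  have hKd : ∀ C ∈ K, ∀ D ∈ K, ∀ z, z ∈ C → z ∈ D → C = D := fun C hC D hD z hzC hzD =>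
    ((hK C).1 hC).eq_of_mem hP ((hK D).1 hD) hzC hzD
  have two := card_filter_covers_le_two hKd
  have middle : ∀ e ∈ G, ∀ f ∈ G, ∀ g ∈ G, S e ⊂ S f → S f ⊂ S g →
      (K.filter (Covers f)).card ≤ 1 := by
    intro e he f hf g hg hef hfg
    obtain ⟨x, y, rfl, hx, hy⟩ := h.exists_ends hf
    exact card_filter_covers_le_one hKd fun C hC hcov =>
      h.notMem_core he hf hg hef hfg hx hy ((hK C).1 hC) hcov
  rcases G.eq_empty_or_nonempty with h0 | h0
  · simp [h0]
  obtain ⟨e₀, he₀, hlt₀⟩ := h.exists_first subset_rfl h0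
  rw [← Finset.add_sum_erase G _ he₀]
  have t₀ := two e₀
  set G₁ := G.erase e₀ with hG₁
  have hs₁ : G₁ ⊆ G := Finset.erase_subset _ _
  rcases G₁.eq_empty_or_nonempty with h1 | h1
  · rw [h1, Finset.sum_empty]
    omega
  obtain ⟨e₁, he₁, hlt₁⟩ := h.exists_first hs₁ h1
  rw [← Finset.add_sum_erase G₁ _ he₁]
  have t₁ := two e₁
  set G₂ := G₁.erase e₁ with hG₂
  have hs₂ : G₂ ⊆ G₁ := Finset.erase_subset _ _
  rcases G₂.eq_empty_or_nonempty with h2 | h2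
  · rw [h2, Finset.sum_empty]
    omega
  obtain ⟨e₂, he₂, hlt₂⟩ := h.exists_first (hs₂.trans hs₁) h2
  rw [← Finset.add_sum_erase G₂ _ he₂]
  have t₂ := two e₂
  have h01 := hlt₀ e₁ he₁
  have h12 := hlt₁ e₂ he₂
  have hg₁ := hs₁ he₁
  have hg₂ := hs₁ (hs₂ he₂)
  have m₁ := middle e₀ he₀ e₁ hg₁ e₂ hg₂ h01 h12
  set G₃ := G₂.erase e₂ with hG₃
  have hs₃ : G₃ ⊆ G₂ := Finset.erase_subset _ _
  rcases G₃.eq_empty_or_nonempty with h3 | h3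
  · rw [h3, Finset.sum_empty]
    omega
  obtain ⟨e₃, he₃, hlt₃⟩ := h.exists_first (hs₃.trans (hs₂.trans hs₁)) h3
  rw [← Finset.add_sum_erase G₃ _ he₃]
  have t₃ := two e₃
  have h23 := hlt₂ e₃ he₃
  have hg₃ := hs₁ (hs₂ (hs₃ he₃))
  have m₂ := middle e₁ hg₁ e₂ hg₂ e₃ hg₃ h12 h23
  have m₀ : (K.filter (Covers e₀)).card ≤ 1 := by
    obtain ⟨x, y, rfl, hx, hy⟩ := h.exists_ends he₀
    rw [Sym2.eq_swap]
    refine card_filter_covers_le_one hKd fun C hC _ hyC => ?_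
    have hy₁ := h.mem_of_subset he₀ hg₁ (fun h => h01.ne (h ▸ rfl)) h01.1 hx
    exact h.not_diff_subset_core hg₁ hg₂ hg₃ h12 h23 ((hK C).1 hC)
      (h.diff_subset_core he₀ hg₁ hg₃ (h12.trans h23) ((hK C).1 hC) hyC hy₁ hy)
  rcases (G₃.erase e₃).eq_empty_or_nonempty with h4 | ⟨e₄, he₄⟩
  · rw [h4, Finset.sum_empty]
    omega
  have h34 := hlt₃ e₄ he₄
  have hg₄ := hs₁ (hs₂ (hs₃ (Finset.mem_of_mem_erase he₄)))
  obtain ⟨C, hC, z, hzC, hz₂, hz₁⟩ := h.exists_mem_core he₀ hg₁ hg₂ h01 h12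
  exact absurd (h.diff_subset_core hg₁ hg₂ hg₄ (h23.trans h34) hC hzC hz₂ hz₁)
    (h.not_diff_subset_core hg₂ hg₃ hg₄ h23 h34 hC)

end CoreChain

end Cores

end SFEC

open SFEC

theorem stmt_18 {V : Type*} [Fintype V]
    (F : Set (Set V)) (hF : IsSetFamily F) (hgp : GammaPliable F)
    (hsym : ∀ S ∈ F, Set.univ \ S ∈ F)
    (I : Finset (Sym2 V)) (hIe : ∀ e ∈ I, ¬ e.IsDiag)
    (hmin : MinimalCover I F)
    (hcov : ∀ e ∈ I, ∃ C : Set V, Core F C ∧ Covers e C) :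
    ∑ C ∈ (Set.toFinite {C : Set V | Core F C}).toFinset, d I C ≤
      10 * ({C : Set V | Core F C}.ncard - 1) := by
  classical
  have hP := hgp.1
  have hs : ∀ S ∈ F, Sᶜ ∈ F := fun S hS => Set.compl_eq_univ_sdiff S ▸ hsym S hS
  have hc : ∀ S ∈ F, ∃ e ∈ I, Covers e S := by
    intro S hS
    obtain ⟨e, he⟩ := Finset.card_pos.1 (hmin.1 S hS)
    exact ⟨e, Finset.mem_filter.1 he⟩
  have hw : ∀ e ∈ I, ∃ S, WitnessSet F I S e := by
    intro e he
    have h := hmin.2 _ (Finset.erase_ssubset he)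
    simp only [CoversFam, not_forall] at h
    obtain ⟨S, hS, h0⟩ := h
    have key : ∀ f ∈ I, Covers f S → f = e := by
      intro f hf hfS
      by_contra hfe
      exact h0 (Finset.card_pos.2
        ⟨f, Finset.mem_filter.2 ⟨Finset.mem_erase.2 ⟨hfe, hf⟩, hfS⟩⟩)
    obtain ⟨f, hf, hfS⟩ := hc S hS
    exact ⟨S, witnessSet_iff.2 ⟨hS, he, key f hf hfS ▸ hfS, key⟩⟩
  set K := (Set.toFinite {C : Set V | Core F C}).toFinset with hKdef
  have hK : ∀ C, C ∈ K ↔ Core F C := fun C => by simp [hKdef]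
  have hcard : {C : Set V | Core F C}.ncard = K.card := Set.ncard_eq_toFinset_card _
  rw [hcard]
  rcases K.eq_empty_or_nonempty with h0 | ⟨C₀, hC₀⟩
  · simp [h0]
  obtain ⟨r, hr⟩ : C₀.Nonempty :=
    Set.nonempty_iff_ne_empty.2 fun h => hF.1 (h ▸ ((hK C₀).1 hC₀).1)
  obtain ⟨S, hS, hlam⟩ := exists_laminar_witnessSets hP hs hc hw r
  let key : Sym2 V → Finset (Set V) := fun e => K.filter (· ⊆ S e)
  have hkey : ∀ e C, C ∈ key e ↔ Core F C ∧ C ⊆ S e := fun e C => by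
    simp only [key, Finset.mem_filter, hK]
  have hkey_ne : ∀ e ∈ I, (key e).Nonempty := by
    intro e he
    obtain ⟨C, hC⟩ := exists_core_subset (hS e he).1.1
    exact ⟨C, (hkey e C).2 hC⟩
  have hdisj : ∀ e f, Disjoint (S e) (S f) → Disjoint (key e) (key f) := by
    intro e f h
    refine Finset.disjoint_left.2 fun C hCe hCf => ?_
    rw [hkey] at hCe hCf
    refine hF.1 ?_
    rw [← Set.subset_empty_iff.1 (h hCe.2 hCf.2)]
    exact hCe.1.1
  have hcount : (I.image key).card ≤ 2 * (K.erase C₀).card := by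
    refine card_le_two_mul_card_of_laminar _ _ (fun A hA => ?_) (fun A hA B hB => ?_)
    · obtain ⟨e, he, rfl⟩ := Finset.mem_image.1 hA
      refine ⟨hkey_ne e he, fun C hC => ?_⟩
      rw [hkey] at hC
      exact Finset.mem_erase.2 ⟨fun h => (hS e he).2 (hC.2 (h ▸ hr)), (hK C).2 hC.1⟩
    · obtain ⟨e, he, rfl⟩ := Finset.mem_image.1 hA
      obtain ⟨f, hf, rfl⟩ := Finset.mem_image.1 hB
      have mono : ∀ e f, S e ⊆ S f → key e ⊆ key f := fun e f h C hC => by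
        rw [hkey] at hC ⊢
        exact ⟨hC.1, hC.2.trans h⟩
      exact (hlam e he f hf).imp (mono e f) (Or.imp (mono f e) (hdisj e f))
  have hfiber : ∀ k ∈ I.image key,
      ∑ e ∈ I with key e = k, (K.filter (Covers e)).card ≤ 5 := by
    intro k _
    refine CoreChain.sum_le_five (F := F) (I := I) (S := S) ⟨hF, hgp, ?_, ?_, ?_, ?_⟩ hK
    · exact fun e he => (hS e (Finset.mem_filter.1 he).1).1
    · exact fun e he => hcov e (Finset.mem_filter.1 he).1
    · intro e he f hf
      rw [Finset.mem_filter] at he hf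
      rcases hlam e he.1 f hf.1 with h | h | h
      · exact Or.inl h
      · exact Or.inr h
      · have := hdisj e f h
        rw [he.2, hf.2, disjoint_self] at this
        exact absurd (he.2.trans this) (hkey_ne e he.1).ne_empty
    · intro e he f hf C hC hCe
      rw [Finset.mem_filter] at he hf
      exact ((hkey f C).1 (hf.2.trans he.2.symm ▸ (hkey e C).2 ⟨hC, hCe⟩)).2
  calc ∑ C ∈ K, d I C = ∑ e ∈ I, (K.filter (Covers e)).card :=
        Finset.sum_card_bipartiteAbove_eq_sum_card_bipartiteBelow (fun C e => Covers e C)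
    _ = ∑ k ∈ I.image key, ∑ e ∈ I with key e = k, (K.filter (Covers e)).card :=
        (Finset.sum_fiberwise_of_maps_to (fun e he => Finset.mem_image_of_mem key he) _).symm
    _ ≤ (I.image key).card • 5 := Finset.sum_le_card_nsmul _ _ _ hfiber
    _ ≤ 10 * (K.card - 1) := by
        rw [Finset.card_erase_of_mem hC₀] at hcount
        rw [smul_eq_mul]
        omega
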